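/- Let p₀, p ∈ S² with p ≠ p₀, and let a ∈ (0,π). Then (1/(4π sin²(a/2))) · ∫_{q ∈ B(p₀,a)} ln‖p − q‖ dσ(q) ≥ ln‖p − p₀‖ − 1/2 − cot²(a/2)·ln cos(a/2), with equality if p ∉ B(p₀,a). -/

import Mathlib

open MeasureTheory Real Filter
open scoped RealInnerProductSpace

noncomputable abbrev E3 := EuclideanSpace ℝ (Fin 3)

noncomputable abbrev S2 := Metric.sphere (0 : E3) 1

/-- The surface measure on the unit sphere `S²` (total mass `4π`). -/
noncomputable def σ2 : Measure S2 := (volume : Measure E3).toSphere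

open scoped Pointwise

/-- The point of `S²` with polar angle `θ` and azimuth `φ` in the orthonormal frame `b`. -/
noncomputable def sphericalPoint (b : OrthonormalBasis (Fin 3) ℝ E3) (θ φ : ℝ) : S2 :=
  ⟨cos θ • b 0 + (sin θ * cos φ) • b 1 + (sin θ * sin φ) • b 2, by
    have h : cos θ • b 0 + (sin θ * cos φ) • b 1 + (sin θ * sin φ) • b 2 =
        b.repr.symm (!₂[cos θ, sin θ * cos φ, sin θ * sin φ]) := by
      rw [← b.sum_repr_symm]; simp [Fin.sum_univ_three]
    rw [mem_sphere_zero_iff_norm, h, LinearIsometryEquiv.norm_map, EuclideanSpace.norm_eq,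
      Real.sqrt_eq_one]
    simp only [Fin.sum_univ_three, Real.norm_eq_abs, sq_abs]
    simp
    nlinarith [sin_sq_add_cos_sq θ, sin_sq_add_cos_sq φ]⟩

lemma continuous_sphericalPoint (b : OrthonormalBasis (Fin 3) ℝ E3) :
    Continuous fun x : ℝ × ℝ => sphericalPoint b x.1 x.2 := by
  unfold sphericalPoint
  fun_prop

lemma measurePreserving_frame (b : OrthonormalBasis (Fin 3) ℝ E3) :
    MeasurePreserving (fun x : ℝ × ℝ × ℝ => x.1 • b 0 + x.2.1 • b 1 + x.2.2 • b 2) := by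
  have h1 := ((volume_preserving_finTwoArrow ℝ).symm)
  have h2 := (MeasurePreserving.id (volume : Measure ℝ)).prod h1
  have h3 := (volume_preserving_piFinSuccAbove (fun _ : Fin 3 => ℝ) 0).symm
  have h4 := b.measurePreserving_repr_symm.comp
    ((PiLp.volume_preserving_toLp (Fin 3)).comp (h3.comp h2))
  have hx : ∀ v : Fin 3 → ℝ, b.repr.symm (WithLp.toLp 2 v) =
      v 0 • b 0 + v 1 • b 1 + v 2 • b 2 := fun v => by
    rw [← b.sum_repr_symm]; simp [Fin.sum_univ_three]
  refine (congrArg (MeasurePreserving · volume volume) (funext fun x => ?_)).mpr h4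
  simp only [Function.comp_apply, hx]
  rfl

lemma smul_mem_cone_iff (s : Set S2) (q : S2) {ρ : ℝ} (hρ : 0 < ρ) :
    ρ • (q : E3) ∈ Set.Ioo (0 : ℝ) 1 • ((↑) '' s : Set E3) ↔ ρ < 1 ∧ q ∈ s := by
  constructor
  · rintro ⟨r, hr, _, ⟨q', hq', rfl⟩, h⟩
    have h' : r • (q' : E3) = ρ • (q : E3) := h
    have hn := congrArg norm h'
    rw [norm_smul, norm_smul, norm_eq_of_mem_sphere, norm_eq_of_mem_sphere, mul_one, mul_one,
      Real.norm_of_nonneg hr.1.le, Real.norm_of_nonneg hρ.le] at hn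
    subst hn
    have := smul_right_injective E3 hr.1.ne' h'
    rw [← Subtype.ext this]
    exact ⟨hr.2, hq'⟩
  · rintro ⟨h, hq⟩
    exact ⟨ρ, ⟨hρ, h⟩, q, ⟨q, hq, rfl⟩, rfl⟩

lemma measurableSet_cone {s : Set S2} (hs : MeasurableSet s) :
    MeasurableSet (Set.Ioo (0 : ℝ) 1 • ((↑) '' s : Set E3)) := by
  have h : Set.Ioo (0 : ℝ) 1 • ((↑) '' s : Set E3) =
      {x : E3 | ‖x‖ ∈ Set.Ioo (0 : ℝ) 1} ∩ (fun x : E3 => ‖x‖⁻¹ • x) ⁻¹' ((↑) '' s) := by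
    ext x
    constructor
    · rintro ⟨r, hr, _, ⟨q, hq, rfl⟩, rfl⟩
      have : ‖r • (q : E3)‖ = r := by
        rw [norm_smul, norm_eq_of_mem_sphere, mul_one, Real.norm_of_nonneg hr.1.le]
      refine ⟨by rwa [Set.mem_ofPred_eq, this], ?_⟩
      simp only [Set.mem_preimage]
      rw [this, inv_smul_smul₀ hr.1.ne']
      exact ⟨q, hq, rfl⟩
    · rintro ⟨hx, hx'⟩
      exact ⟨‖x‖, hx, _, hx', smul_inv_smul₀ hx.1.ne' x⟩
  rw [h]
  refine .inter (measurable_norm measurableSet_Ioo) ?_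
  exact (by fun_prop : Measurable fun x : E3 => ‖x‖⁻¹ • x)
    ((MeasurableEmbedding.subtype_coe Metric.isClosed_sphere.measurableSet).measurableSet_image' hs)

lemma lintegral_Ioi_sq_indicator :
    ∫⁻ ρ in Set.Ioi (0 : ℝ), ENNReal.ofReal (ρ ^ 2) * (Set.Iio (1 : ℝ)).indicator 1 ρ = 1 / 3 := by
  have h (ρ : ℝ) : ENNReal.ofReal (ρ ^ 2) * (Set.Iio (1 : ℝ)).indicator 1 ρ =
      (Set.Iio (1 : ℝ)).indicator (fun ρ => ENNReal.ofReal (ρ ^ 2)) ρ := by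
    by_cases hρ : ρ ∈ Set.Iio (1 : ℝ) <;> simp [hρ]
  simp_rw [h]
  rw [setLIntegral_indicator measurableSet_Iio, Set.inter_comm, Set.Ioi_inter_Iio,
    setLIntegral_congr Ioo_ae_eq_Ioc, ← ofReal_integral_eq_lintegral_ofReal,
    ← intervalIntegral.integral_of_le zero_le_one, integral_pow]
  · rw [← ENNReal.ofReal_ofNat, ← ENNReal.ofReal_one, ← ENNReal.ofReal_div_of_pos (by norm_num)]
    norm_num
  · exact (intervalIntegrable_iff_integrableOn_Ioc_of_le zero_le_one).1
      ((continuous_pow 2).intervalIntegrable 0 1)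
  · exact ae_of_all _ fun x => sq_nonneg x

lemma lintegral_sin_mul_eq (M : ℝ → ENNReal) :
    ∫⁻ θ in Set.Ioo (-π) π, ENNReal.ofReal (sin θ) * M θ =
      ∫⁻ u in Set.Ioo (-1) 1, M (arccos u) := by
  have himg : cos '' Set.Ioo 0 π = Set.Ioo (-1) 1 := by
    ext u
    constructor
    · rintro ⟨θ, hθ, rfl⟩
      constructor
      · rw [← cos_pi]
        exact strictAntiOn_cos ⟨hθ.1.le, hθ.2.le⟩ ⟨pi_pos.le, le_rfl⟩ hθ.2
      · rw [← cos_zero]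
        exact strictAntiOn_cos ⟨le_rfl, pi_pos.le⟩ ⟨hθ.1.le, hθ.2.le⟩ hθ.1
    · rintro ⟨h1, h2⟩
      exact ⟨arccos u, ⟨arccos_pos.2 h2, arccos_lt_pi.2 h1⟩, cos_arccos h1.le h2.le⟩
  rw [← himg, lintegral_image_eq_lintegral_abs_deriv_mul measurableSet_Ioo
    (fun x _ => (hasDerivAt_cos x).hasDerivWithinAt)
    (injOn_cos.mono Set.Ioo_subset_Icc_self)]
  have h (θ : ℝ) (hθ : θ ∈ Set.Ioo (-π) π) : ENNReal.ofReal (sin θ) * M θ =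
      (Set.Ioi (0 : ℝ)).indicator (fun θ => ENNReal.ofReal (sin θ) * M θ) θ := by
    by_cases h0 : 0 < θ
    · simp [h0]
    · rw [Set.indicator_of_notMem (by simpa using h0), ENNReal.ofReal_of_nonpos, zero_mul]
      exact sin_nonpos_of_nonpos_of_neg_pi_le (not_lt.1 h0) hθ.1.le
  rw [setLIntegral_congr_fun measurableSet_Ioo h, setLIntegral_indicator measurableSet_Ioi]
  have hs : Set.Ioi 0 ∩ Set.Ioo (-π) π = Set.Ioo 0 π := by
    ext x; simp; intro h _; linarith [pi_pos]
  rw [hs]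
  refine setLIntegral_congr_fun measurableSet_Ioo fun θ hθ => ?_
  rw [abs_neg, abs_of_pos (sin_pos_of_mem_Ioo hθ), arccos_cos hθ.1.le hθ.2.le]

lemma σ2_apply_eq_lintegral (b : OrthonormalBasis (Fin 3) ℝ E3) {s : Set S2}
    (hs : MeasurableSet s) :
    σ2 s = ∫⁻ u in Set.Ioo (-1) 1, ∫⁻ φ in Set.Ioo (-π) π,
      s.indicator 1 (sphericalPoint b (arccos u) φ) := by
  set A : Set E3 := Set.Ioo (0 : ℝ) 1 • ((↑) '' s : Set E3) with hA
  have hAm : MeasurableSet A := measurableSet_cone hs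
  set F : ℝ × ℝ × ℝ → E3 := fun x => x.1 • b 0 + x.2.1 • b 1 + x.2.2 • b 2 with hF
  have hFm : Measurable F := by fun_prop
  set G : ℝ × ℝ × ℝ → ENNReal := fun x => A.indicator 1 (F x) with hG
  have hGm : Measurable G := (measurable_one.indicator hAm).comp hFm
  set K : ℝ × ℝ → ENNReal := fun y => ∫⁻ φ in Set.Ioo (-π) π,
    ENNReal.ofReal y.2 * G (y.1, y.2 * cos φ, y.2 * sin φ) with hK
  have hKm : Measurable K := by
    refine Measurable.lintegral_prod_right' (f := fun w : (ℝ × ℝ) × ℝ =>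
      ENNReal.ofReal w.1.2 * G (w.1.1, w.1.2 * cos w.2, w.1.2 * sin w.2)) ?_
    exact (by fun_prop : Measurable fun w : (ℝ × ℝ) × ℝ => ENNReal.ofReal w.1.2).mul
      (hGm.comp (by fun_prop))
  set M : ℝ → ENNReal := fun θ => ∫⁻ φ in Set.Ioo (-π) π,
    s.indicator 1 (sphericalPoint b θ φ) with hM
  have hsph : Measurable fun x : ℝ × ℝ => s.indicator (1 : S2 → ENNReal)
      (sphericalPoint b x.1 x.2) :=
    (measurable_one.indicator hs).comp (continuous_sphericalPoint b).measurable
  have hMm : Measurable M := Measurable.lintegral_prod_right' hsph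
  have htarget : (volume : Measure (ℝ × ℝ)).restrict polarCoord.target =
      (volume.restrict (Set.Ioi 0)).prod (volume.restrict (Set.Ioo (-π) π)) :=
    (Measure.prod_restrict _ _).symm
  have hvol : volume A = ∫⁻ z, ∫⁻ r in Set.Ioi 0, K (z, r) := by
    rw [← (measurePreserving_frame b).measure_preimage hAm.nullMeasurableSet,
      ← lintegral_indicator_one (hFm hAm)]
    change ∫⁻ x, G x = _
    rw [Measure.volume_eq_prod, lintegral_prod _ hGm.aemeasurable]
    refine lintegral_congr fun z => ?_
    rw [← lintegral_comp_polarCoord_symm, htarget, lintegral_prod]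
    · rfl
    · refine Measurable.aemeasurable ?_
      exact (by fun_prop : Measurable fun w : ℝ × ℝ => ENNReal.ofReal w.1).mul
        (hGm.comp (by simp only [polarCoord_symm_apply]; fun_prop))
  have hK' : ∀ ρ θ : ℝ, 0 < ρ → 0 < sin θ → K (ρ * cos θ, ρ * sin θ) =
      ENNReal.ofReal (ρ * sin θ) * ((Set.Iio (1 : ℝ)).indicator 1 ρ * M θ) := by
    intro ρ θ hρ hθ
    simp only [hK, hM]
    rw [lintegral_const_mul' _ _ ENNReal.ofReal_ne_top,
      ← lintegral_const_mul' ((Set.Iio (1 : ℝ)).indicator 1 ρ) _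
        (by by_cases h : ρ < 1 <;> simp [h])]
    congr 1
    refine lintegral_congr fun φ => ?_
    have hFp : F (ρ * cos θ, ρ * sin θ * cos φ, ρ * sin θ * sin φ) =
        ρ • (sphericalPoint b θ φ : E3) := by
      simp only [hF, sphericalPoint, smul_add, smul_smul, mul_assoc]
    simp only [hG, hFp]
    have := smul_mem_cone_iff s (sphericalPoint b θ φ) hρ
    by_cases h1 : ρ < 1 <;> by_cases h2 : sphericalPoint b θ φ ∈ s <;>
      simp [hA, this, h1, h2]
  have hvol' : volume A = (1 / 3) * ∫⁻ θ in Set.Ioo (-π) π, ENNReal.ofReal (sin θ) * M θ := by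
    have h1 (z : ℝ) : ∫⁻ r in Set.Ioi 0, K (z, r) =
        ∫⁻ r, (Set.univ ×ˢ Set.Ioi (0 : ℝ)).indicator K (z, r) := by
      rw [← lintegral_indicator measurableSet_Ioi]
      refine lintegral_congr fun r => ?_
      by_cases hr : 0 < r <;> simp [hr, Set.indicator]
    rw [hvol]
    simp_rw [h1]
    rw [← lintegral_prod (fun w => (Set.univ ×ˢ Set.Ioi (0 : ℝ)).indicator K w)
      (hKm.indicator (MeasurableSet.univ.prod measurableSet_Ioi)).aemeasurable,
      ← Measure.volume_eq_prod, ← lintegral_comp_polarCoord_symm,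
      ← lintegral_Ioi_sq_indicator, ← lintegral_prod_mul, ← htarget]
    · refine setLIntegral_congr_fun (measurableSet_Ioi.prod measurableSet_Ioo) ?_
      rintro ⟨ρ, θ⟩ ⟨hρ, hθ⟩
      have hρ : 0 < ρ := hρ
      simp only [polarCoord_symm_apply, smul_eq_mul]
      by_cases h : 0 < sin θ
      · rw [Set.indicator_of_mem (by simp [hρ, h]), hK' ρ θ hρ h, ENNReal.ofReal_mul hρ.le,
          pow_two, ENNReal.ofReal_mul hρ.le]
        ring
      · rw [Set.indicator_of_notMem (by simp [hρ]; exact not_lt.1 h),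
          ENNReal.ofReal_of_nonpos (not_lt.1 h)]
        simp
    · exact ((by fun_prop : Measurable fun ρ : ℝ => ENNReal.ofReal (ρ ^ 2)).mul
        (measurable_one.indicator measurableSet_Iio)).aemeasurable
    · exact ((by fun_prop : Measurable fun ρ : ℝ => ENNReal.ofReal (sin ρ)).mul hMm).aemeasurable
  rw [σ2, Measure.toSphere_apply' _ hs, ← hA, hvol', lintegral_sin_mul_eq, ← mul_assoc]
  simp only [finrank_euclideanSpace, Fintype.card_fin]
  rw [one_div, Nat.cast_ofNat, ENNReal.mul_inv_cancel (by norm_num) (by norm_num), one_mul]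

/-- Archimedes on the sphere: height and azimuth are area-preserving coordinates on `S²`. -/
lemma measurePreserving_cylindrical (b : OrthonormalBasis (Fin 3) ℝ E3) :
    MeasurePreserving (fun x : ℝ × ℝ => sphericalPoint b (arccos x.1) x.2)
      ((volume.restrict (Set.Ioo (-1) 1)).prod (volume.restrict (Set.Ioo (-π) π))) σ2 := by
  have hm : Measurable fun x : ℝ × ℝ => sphericalPoint b (arccos x.1) x.2 :=
    ((continuous_sphericalPoint b).comp
      ((continuous_arccos.comp continuous_fst).prodMk continuous_snd)).measurable
  refine ⟨hm, ?_⟩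
  ext s hs
  rw [Measure.map_apply hm hs, σ2_apply_eq_lintegral b hs, ← lintegral_indicator_one (hm hs),
    lintegral_prod _ (measurable_one.indicator (hm hs)).aemeasurable]
  rfl

lemma exists_orthonormalBasis_zero_eq (p : S2) :
    ∃ b : OrthonormalBasis (Fin 3) ℝ E3, b 0 = p := by
  have hv : Orthonormal ℝ (({0} : Set (Fin 3)).domRestrict fun _ => (p : E3)) := by
    refine ⟨fun _ => norm_eq_of_mem_sphere p, fun i j hij => ?_⟩
    exact absurd (Subsingleton.elim i j) hij
  obtain ⟨b, hb⟩ := hv.exists_orthonormalBasis_extension_of_card_eq (by simp)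
  exact ⟨b, hb 0 rfl⟩

lemma log_norm_sub_eq (p q : S2) :
    log ‖(p : E3) - (q : E3)‖ = 1 / 2 * log (2 - 2 * ⟪(p : E3), (q : E3)⟫) := by
  have h : ‖(p : E3) - (q : E3)‖ ^ 2 = 2 - 2 * ⟪(p : E3), (q : E3)⟫ := by
    rw [norm_sub_sq_real, norm_eq_of_mem_sphere, norm_eq_of_mem_sphere]
    ring
  rw [← h, log_pow]
  push_cast
  ring

lemma inner_sphericalPoint (b : OrthonormalBasis (Fin 3) ℝ E3) (p : E3) (θ φ : ℝ) :
    ⟪p, (sphericalPoint b θ φ : E3)⟫ =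
      cos θ * ⟪p, b 0⟫ + sin θ * (⟪p, b 1⟫ * cos φ + ⟪p, b 2⟫ * sin φ) := by
  simp only [sphericalPoint, inner_add_right, real_inner_smul_right]
  ring

lemma inner_zero_sphericalPoint (b : OrthonormalBasis (Fin 3) ℝ E3) (θ φ : ℝ) :
    ⟪b 0, (sphericalPoint b θ φ : E3)⟫ = cos θ := by
  rw [inner_sphericalPoint]
  simp [b.inner_eq_ite]

lemma integrable_log_norm_sub (p : S2) :
    Integrable (fun q : S2 => log ‖(p : E3) - (q : E3)‖) σ2 := by
  obtain ⟨b, hb⟩ := exists_orthonormalBasis_zero_eq p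
  have hm : Measurable fun q : S2 => log ‖(p : E3) - (q : E3)‖ := by fun_prop
  rw [← (measurePreserving_cylindrical b).integrable_comp hm.aestronglyMeasurable]
  have hlog : IntegrableOn (fun u : ℝ => 1 / 2 * log (2 - 2 * u)) (Set.Ioo (-1) 1) := by
    rw [← integrableOn_Ioc_iff_integrableOn_Ioo,
      ← intervalIntegrable_iff_integrableOn_Ioc_of_le (by norm_num)]
    have := ((intervalIntegral.intervalIntegrable_log' (a := 4)
      (b := 0)).comp_sub_left 2).comp_mul_left (c := 2)
    norm_num at this
    exact this.const_mul (1 / 2)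
  refine (hlog.comp_fst (volume.restrict (Set.Ioo (-π) π))).congr ?_
  rw [Measure.prod_restrict]
  refine ae_restrict_of_forall_mem (measurableSet_Ioo.prod measurableSet_Ioo) ?_
  rintro ⟨u, φ⟩ ⟨hu, -⟩
  simp only [Function.comp_apply]
  rw [log_norm_sub_eq, ← hb, inner_zero_sphericalPoint, cos_arccos hu.1.le hu.2.le]

lemma integral_Ioo_circleMap (f : ℂ → ℝ) (R : ℝ) :
    ∫ φ in Set.Ioo (-π) π, f (circleMap 0 R φ) = 2 * π * circleAverage f 0 R := by
  have hp : (fun φ => f (circleMap 0 R φ)).Periodic (2 * π) :=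
    fun φ => congrArg f (periodic_circleMap 0 R φ)
  have h := hp.intervalIntegral_add_eq (-π) 0
  rw [show -π + 2 * π = π by ring, zero_add] at h
  rw [← integral_Ioc_eq_integral_Ioo, ← intervalIntegral.integral_of_le (by linarith [pi_pos]), h,
    circleAverage_def, smul_eq_mul, ← mul_assoc, mul_inv_cancel₀ (by positivity), one_mul]

/-- The integral over the parallel at height `u` of the logarithmic potential of a point at
height `s` on the unit sphere. -/
lemma integral_log_parallel {u s x y : ℝ} (hu : u ∈ Set.Ioo (-1) 1)
    (hs : s ^ 2 + x ^ 2 + y ^ 2 = 1) (hs0 : -1 < s) (hs1 : s < 1) (hus : u ≠ s) :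
    ∫ φ in Set.Ioo (-π) π,
        1 / 2 * log (2 - 2 * (u * s + √(1 - u ^ 2) * (x * cos φ + y * sin φ))) =
      π * (log (1 + u) + log (1 - s) +
        2 * (log⁺ √((1 - s) * (1 + u) / ((1 + s) * (1 - u))) -
          log √((1 - s) * (1 + u) / ((1 + s) * (1 - u))))) := by
  obtain ⟨hu0, hu1⟩ := hu
  have h1 : 0 < 1 + u := by linarith
  have h2 : 0 < 1 - u := by linarith
  have h3 : 0 < 1 + s := by linarith
  have h4 : 0 < 1 - s := by linarith
  set R : ℝ := √(1 - u ^ 2) / (1 + u) with hR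
  have hR2 : R ^ 2 = (1 - u) / (1 + u) := by
    rw [hR, div_pow, sq_sqrt (by nlinarith)]
    field_simp
    ring
  have hR0 : 0 < R := by
    have : 0 < 1 - u ^ 2 := by nlinarith
    positivity
  set w : ℂ := ⟨x / (1 + s), y / (1 + s)⟩ with hw
  have hw2 : ‖w‖ ^ 2 = (1 - s) / (1 + s) := by
    rw [← Complex.normSq_eq_norm_sq, Complex.normSq_mk]
    field_simp
    nlinarith
  have hw0 : ‖w‖ ≠ 0 := by
    intro h
    rw [h, eq_comm, zero_pow two_ne_zero, div_eq_zero_iff] at hw2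
    rcases hw2 with h | h <;> linarith
  have hne : ‖w‖ ^ 2 ≠ R ^ 2 := by
    rw [hw2, hR2, Ne, div_eq_div_iff h3.ne' h1.ne']
    intro h
    exact hus (by linarith)
  have hQ : R⁻¹ * ‖w‖ = √((1 - s) * (1 + u) / ((1 + s) * (1 - u))) := by
    rw [eq_comm, sqrt_eq_iff_eq_sq (by positivity) (by positivity), mul_pow, inv_pow, hR2, hw2]
    field_simp
  have hz (φ : ℝ) : ‖circleMap 0 R φ - w‖ ≠ 0 := by
    rw [norm_ne_zero_iff, sub_ne_zero]
    intro h
    apply hne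
    rw [← h, norm_circleMap_zero, sq_abs]
  have hint (φ : ℝ) : 1 / 2 * log (2 - 2 * (u * s + √(1 - u ^ 2) * (x * cos φ + y * sin φ))) =
      1 / 2 * (log (1 + u) + log (1 + s)) + log ‖circleMap 0 R φ - w‖ := by
    have := hz φ
    have hsq : 2 - 2 * (u * s + √(1 - u ^ 2) * (x * cos φ + y * sin φ)) =
        (1 + u) * (1 + s) * ‖circleMap 0 R φ - w‖ ^ 2 := by
      have hn : ‖circleMap 0 R φ - w‖ ^ 2 =
          R ^ 2 + ‖w‖ ^ 2 - 2 * R * (x * cos φ + y * sin φ) / (1 + s) := by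
        rw [← Complex.normSq_eq_norm_sq, ← Complex.normSq_eq_norm_sq, Complex.normSq_apply,
          Complex.normSq_apply]
        simp only [Complex.sub_re, Complex.sub_im, circleMap_zero, Complex.re_ofReal_mul,
          Complex.im_ofReal_mul, Complex.exp_ofReal_mul_I_re, Complex.exp_ofReal_mul_I_im, hw]
        linear_combination R ^ 2 * sin_sq_add_cos_sq φ
      rw [hn, hR2, hw2, hR]
      field_simp
      ring
    rw [hsq, log_mul (by positivity) (by positivity), log_mul h1.ne' h3.ne', log_pow]
    push_cast
    ring
  simp_rw [hint]
  have hci : IntegrableOn (fun φ => log ‖circleMap 0 R φ - w‖) (Set.Ioo (-π) π) :=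
    ((((continuous_circleMap 0 R).sub continuous_const).norm.log hz).integrableOn_Icc).mono_set
      Set.Ioo_subset_Icc_self
  rw [integral_add (integrable_const _) hci,
    integral_Ioo_circleMap (fun z => log ‖z - w‖) R,
    circleAverage_log_norm_sub_const_eq_log_radius_add_posLog hR0.ne', zero_sub, norm_neg, hQ,
    setIntegral_const, ← hQ, log_mul (by positivity) hw0, log_inv]
  have hlw : 2 * log ‖w‖ = log (1 - s) - log (1 + s) := by
    rw [← log_div h4.ne' h3.ne', ← hw2, log_pow]; norm_num
  have hv : volume.real (Set.Ioo (-π) π) = 2 * π := by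
    rw [Real.volume_real_Ioo_of_le (by linarith [pi_pos])]; ring
  rw [hv, smul_eq_mul]
  linear_combination π * hlw

lemma integral_log_parallel_ge {u s x y : ℝ} (hu : u ∈ Set.Ioo (-1) 1)
    (hs : s ^ 2 + x ^ 2 + y ^ 2 = 1) (hs1 : s < 1) (hus : u ≠ s) :
    π * (log (1 + u) + log (1 - s)) ≤ ∫ φ in Set.Ioo (-π) π,
        1 / 2 * log (2 - 2 * (u * s + √(1 - u ^ 2) * (x * cos φ + y * sin φ))) ∧
      (s ≤ u → ∫ φ in Set.Ioo (-π) π,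
        1 / 2 * log (2 - 2 * (u * s + √(1 - u ^ 2) * (x * cos φ + y * sin φ))) =
          π * (log (1 + u) + log (1 - s))) := by
  have hs0 : -1 ≤ s := by nlinarith [sq_nonneg x, sq_nonneg y]
  rcases hs0.eq_or_lt with rfl | hs0
  · have hx : x = 0 := by nlinarith [sq_nonneg x, sq_nonneg y]
    have hy : y = 0 := by nlinarith [sq_nonneg x, sq_nonneg y]
    have h : ∫ φ in Set.Ioo (-π) π,
        1 / 2 * log (2 - 2 * (u * (-1) + √(1 - u ^ 2) * (x * cos φ + y * sin φ))) =
          π * (log (1 + u) + log (1 - -1)) := by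
      rw [← log_mul (by linarith [hu.1]) (by norm_num)]
      simp only [hx, hy, zero_mul, add_zero, mul_zero, setIntegral_const]
      rw [Real.volume_real_Ioo_of_le (by linarith [pi_pos]), smul_eq_mul]
      ring_nf
    exact ⟨h.ge, fun _ => h⟩
  · rw [integral_log_parallel hu hs hs0 hs1 hus]
    set Q := √((1 - s) * (1 + u) / ((1 + s) * (1 - u))) with hQ
    refine ⟨?_, fun h => ?_⟩
    · have : log Q ≤ log⁺ Q := le_max_right _ _
      nlinarith [pi_pos]
    · have : log⁺ Q = log Q := by
        rw [posLog_eq_log]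
        rw [hQ, abs_of_nonneg (sqrt_nonneg _), one_le_sqrt, one_le_div]
        · nlinarith
        · nlinarith [hu.1, hu.2]
      rw [this]; ring

lemma integral_cap_log_norm_sub (b : OrthonormalBasis (Fin 3) ℝ E3) (p p₀ : S2) (hb : b 0 = p₀) {a : ℝ}
    (ha : a ∈ Set.Ioo 0 π) :
    IntegrableOn (fun u => ∫ φ in Set.Ioo (-π) π,
      log ‖(p : E3) - (sphericalPoint b (arccos u) φ : E3)‖) (Set.Ioo (cos a) 1) ∧
    ∫ q in {q : S2 | arccos ⟪(p₀ : E3), (q : E3)⟫ < a}, log ‖(p : E3) - (q : E3)‖ ∂σ2 =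
      ∫ u in Set.Ioo (cos a) 1, ∫ φ in Set.Ioo (-π) π,
        log ‖(p : E3) - (sphericalPoint b (arccos u) φ : E3)‖ := by
  set B : Set S2 := {q : S2 | arccos ⟪(p₀ : E3), (q : E3)⟫ < a} with hB
  have hBm : MeasurableSet B :=
    measurableSet_lt (by fun_prop) measurable_const
  have hmp := (measurePreserving_cylindrical b).restrict_preimage hBm
  have hset : (fun x : ℝ × ℝ => sphericalPoint b (arccos x.1) x.2) ⁻¹' B ∩
      Set.Ioo (-1) 1 ×ˢ Set.Ioo (-π) π = Set.Ioo (cos a) 1 ×ˢ Set.Ioo (-π) π := by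
    have hca : -1 < cos a := by
      rw [← cos_pi]
      exact strictAntiOn_cos ⟨ha.1.le, ha.2.le⟩ ⟨pi_pos.le, le_rfl⟩ ha.2
    have key (u : ℝ) (hu : u ∈ Set.Ioo (-1) 1) : arccos u < a ↔ cos a < u := by
      rw [← strictAntiOn_cos.lt_iff_gt ⟨ha.1.le, ha.2.le⟩ ⟨arccos_nonneg u, arccos_le_pi u⟩,
        cos_arccos hu.1.le hu.2.le]
    ext ⟨u, φ⟩
    simp only [Set.mem_inter_iff, Set.mem_preimage, Set.mem_prod, hB, Set.mem_ofPred_eq, ← hb,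
      inner_zero_sphericalPoint]
    constructor
    · rintro ⟨h, hu, hφ⟩
      rw [cos_arccos hu.1.le hu.2.le, key u hu] at h
      exact ⟨⟨h, hu.2⟩, hφ⟩
    · rintro ⟨hu, hφ⟩
      have hu' : u ∈ Set.Ioo (-1) 1 := ⟨hca.trans hu.1, hu.2⟩
      refine ⟨?_, hu', hφ⟩
      rw [cos_arccos hu'.1.le hu'.2.le, key u hu']
      exact hu.1
  rw [Measure.prod_restrict, Measure.restrict_restrict (hmp.measurable hBm), hset,
    ← Measure.prod_restrict] at hmp
  have hm : Measurable fun q : S2 => log ‖(p : E3) - (q : E3)‖ := by fun_prop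
  have hi := (hmp.integrable_comp hm.aestronglyMeasurable).2
    (integrable_log_norm_sub p).integrableOn
  refine ⟨hi.integral_prod_left, ?_⟩
  rw [← hmp.map_eq, integral_map hmp.aemeasurable hm.aestronglyMeasurable]
  exact integral_prod _ hi

lemma integral_log_one_add {c k : ℝ} (hc : c ∈ Set.Ioo (-1) 1) :
    IntegrableOn (fun u => π * (log (1 + u) + k)) (Set.Ioo c 1) ∧
    ∫ u in Set.Ioo c 1, π * (log (1 + u) + k) =
      π * (2 * log 2 - (1 + c) * log (1 + c) - (1 - c) + (1 - c) * k) := by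
  have hi : IntervalIntegrable (fun u => log (1 + u)) volume c 1 := by
    have := (intervalIntegral.intervalIntegrable_log' (a := c + 1) (b := 2)).comp_add_left 1
    norm_num at this
    exact this
  constructor
  · rw [← integrableOn_Ioc_iff_integrableOn_Ioo,
      ← intervalIntegrable_iff_integrableOn_Ioc_of_le hc.2.le]
    exact (hi.add intervalIntegrable_const).const_mul π
  · rw [← integral_Ioc_eq_integral_Ioo, ← intervalIntegral.integral_of_le hc.2.le,
      intervalIntegral.integral_const_mul, intervalIntegral.integral_add hi
      intervalIntegrable_const, intervalIntegral.integral_comp_add_left log, integral_log]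
    rw [intervalIntegral.integral_const, smul_eq_mul]
    norm_num
    ring

theorem stmt_7 (p₀ p : S2) (hne : p ≠ p₀) (a : ℝ) (ha : a ∈ Set.Ioo 0 π) :
    (1 / (4 * π * Real.sin (a / 2) ^ 2) *
        ∫ q in {q : S2 | Real.arccos ⟪(p₀ : E3), (q : E3)⟫ < a},
          Real.log ‖(p : E3) - (q : E3)‖ ∂σ2 ≥
      Real.log ‖(p : E3) - (p₀ : E3)‖ - 1 / 2
        - Real.cot (a / 2) ^ 2 * Real.log (Real.cos (a / 2))) ∧
    (a ≤ Real.arccos ⟪(p₀ : E3), (p : E3)⟫ →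
      1 / (4 * π * Real.sin (a / 2) ^ 2) *
          ∫ q in {q : S2 | Real.arccos ⟪(p₀ : E3), (q : E3)⟫ < a},
            Real.log ‖(p : E3) - (q : E3)‖ ∂σ2 =
        Real.log ‖(p : E3) - (p₀ : E3)‖ - 1 / 2
          - Real.cot (a / 2) ^ 2 * Real.log (Real.cos (a / 2))) := by
  obtain ⟨b, hb⟩ := exists_orthonormalBasis_zero_eq p₀
  obtain ⟨hint, heq⟩ := integral_cap_log_norm_sub b p p₀ hb ha
  rw [heq]
  set s : ℝ := ⟪(p : E3), (p₀ : E3)⟫ with hs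
  have hs1 : s < 1 := by
    rw [hs, inner_lt_one_iff_real_of_norm_eq_one (norm_eq_of_mem_sphere p)
      (norm_eq_of_mem_sphere p₀)]
    exact fun h => hne (Subtype.ext h)
  have hsum : s ^ 2 + ⟪(p : E3), b 1⟫ ^ 2 + ⟪(p : E3), b 2⟫ ^ 2 = 1 := by
    have h := b.sum_sq_inner_left (p : E3)
    rw [norm_eq_of_mem_sphere, Fin.sum_univ_three, hb] at h
    simpa using h
  have hca0 : -1 < cos a := by
    rw [← cos_pi]
    exact strictAntiOn_cos ⟨ha.1.le, ha.2.le⟩ ⟨pi_pos.le, le_rfl⟩ ha.2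
  have hca1 : cos a < 1 := by
    rw [← cos_zero]
    exact strictAntiOn_cos ⟨le_rfl, pi_pos.le⟩ ⟨ha.1.le, ha.2.le⟩ ha.1
  have hpar (u : ℝ) (hu : u ∈ Set.Ioo (cos a) 1) (hus : u ≠ s) :
      π * (log (1 + u) + log (1 - s)) ≤ ∫ φ in Set.Ioo (-π) π,
        log ‖(p : E3) - (sphericalPoint b (arccos u) φ : E3)‖ ∧
      (s ≤ u → ∫ φ in Set.Ioo (-π) π,
        log ‖(p : E3) - (sphericalPoint b (arccos u) φ : E3)‖ =
          π * (log (1 + u) + log (1 - s))) := by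
    have hu' : u ∈ Set.Ioo (-1) 1 := ⟨hca0.trans hu.1, hu.2⟩
    simp_rw [log_norm_sub_eq, inner_sphericalPoint, cos_arccos hu'.1.le hu'.2.le, sin_arccos, hb,
      ← hs]
    exact integral_log_parallel_ge hu' hsum hs1 hus
  obtain ⟨hLi, hL⟩ := integral_log_one_add (k := log (1 - s)) (c := cos a) ⟨hca0, hca1⟩
  have hsin : 0 < sin (a / 2) :=
    sin_pos_of_pos_of_lt_pi (by linarith [ha.1]) (by linarith [ha.1, ha.2])
  have hcos : 0 < cos (a / 2) := cos_pos_of_mem_Ioo ⟨by linarith [ha.1, ha.2], by linarith [ha.2]⟩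
  have hval : 1 / (4 * π * sin (a / 2) ^ 2) *
      (∫ u in Set.Ioo (cos a) 1, π * (log (1 + u) + log (1 - s))) =
      log ‖(p : E3) - (p₀ : E3)‖ - 1 / 2 - cot (a / 2) ^ 2 * log (cos (a / 2)) := by
    have h1 : 1 + cos a = 2 * cos (a / 2) ^ 2 := by
      rw [cos_sq]; ring_nf
    have h2 : 1 - cos a = 2 * sin (a / 2) ^ 2 := by
      rw [sin_sq]; linarith
    have h3 : log (1 + cos a) = log 2 + 2 * log (cos (a / 2)) := by
      rw [h1, log_mul two_ne_zero (by positivity), log_pow]; norm_num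
    have h4 : log ‖(p : E3) - (p₀ : E3)‖ = 1 / 2 * (log 2 + log (1 - s)) := by
      rw [log_norm_sub_eq, ← hs, ← log_mul two_ne_zero (by linarith)]; ring_nf
    rw [hL, h3, h4, h1, h2, cot_eq_cos_div_sin]
    field_simp
    linear_combination (-4 * log 2) * sin_sq_add_cos_sq (a / 2)
  have hae : ∀ᵐ u : ℝ, u ≠ s := Measure.ae_ne volume s
  refine ⟨?_, fun h => ?_⟩
  · rw [ge_iff_le, ← hval]
    refine mul_le_mul_of_nonneg_left ?_ (by positivity)
    refine setIntegral_mono_on_ae hLi hint measurableSet_Ioo ?_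
    filter_upwards [hae] with u hus hu using (hpar u hu hus).1
  · rw [← hval]
    congr 1
    refine setIntegral_congr_ae measurableSet_Ioo ?_
    have hsa : s ≤ cos a := by
      rw [hs, real_inner_comm, ← cos_arccos (x := ⟪(p₀ : E3), (p : E3)⟫)]
      · exact strictAntiOn_cos.antitoneOn ⟨ha.1.le, ha.2.le⟩
          ⟨arccos_nonneg _, arccos_le_pi _⟩ h
      · rw [real_inner_comm]
        nlinarith [sq_nonneg ⟪(p : E3), b 1⟫, sq_nonneg ⟪(p : E3), b 2⟫]
      · rw [real_inner_comm]
        exact hs1.le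
    filter_upwards [hae] with u hus hu using (hpar u hu hus).2 (hsa.trans hu.1.le)
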